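/- (Interior first-order conditions for α-RI.) Fix α ∈ (0,1)∪(1,∞), a prior μ with μ(ω) > 0 for all ω ∈ Ω, a utility u : S × Ω → ℝ, and κ > 0. Let P* be an α-RI optimum and set C := Σ_{s∈S} (Σ_{ω∈Ω} μ(ω)P*(s|ω)^α)^{1/α}. Then there exist real numbers λ_ω (one for each ω ∈ Ω) such that for every pair (s,ω) with P*(s|ω) > 0: (α/(α−1))·C^{−1}·(Σ_{ω̃∈Ω} μ(ω̃)P*(s|ω̃)^α)^{(1−α)/α}·P*(s|ω)^{α−1} = u(s,ω)/κ − λ_ω/μ(ω). -/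

import Mathlib

open Real Finset

/-- A prior: a probability vector on a finite set of states. -/
def IsPrior {Ω : Type*} [Fintype Ω] (μ : Ω → ℝ) : Prop :=
  (∀ ω, 0 ≤ μ ω) ∧ ∑ ω, μ ω = 1

/-- A statistical experiment: a Markov kernel from states to signals. -/
def IsExperiment {Ω S : Type*} [Fintype Ω] [Fintype S] (P : Ω → S → ℝ) : Prop :=
  (∀ ω s, 0 ≤ P ω s) ∧ ∀ ω, ∑ s, P ω s = 1

/-- The α-mutual information `I_α(P, μ)`. -/
noncomputable def alphaMI {Ω S : Type*} [Fintype Ω] [Fintype S]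
    (α : ℝ) (P : Ω → S → ℝ) (μ : Ω → ℝ) : ℝ :=
  (α / (α - 1)) * Real.log (∑ s, (∑ ω, μ ω * P ω s ^ α) ^ (1 / α))


/-- An α-RI optimum: an experiment maximizing expected utility net of
α-mutual-information costs. -/
def IsAlphaRIOptimum {Ω S : Type*} [Fintype Ω] [Fintype S]
    (α : ℝ) (u : S → Ω → ℝ) (κ : ℝ) (μ : Ω → ℝ) (Pstar : Ω → S → ℝ) : Prop :=
  IsExperiment Pstar ∧ ∀ P : Ω → S → ℝ, IsExperiment P →
    (∑ ω, ∑ s, μ ω * P ω s * u s ω) - κ * alphaMI α P μ ≤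
    (∑ ω, ∑ s, μ ω * Pstar ω s * u s ω) - κ * alphaMI α Pstar μ

section FeasibleDirections

variable {Ω S : Type*} [Fintype Ω] {α : ℝ} {μ : Ω → ℝ} {P D : Ω → S → ℝ}

lemma sum_mul_rpow_pos (hμ : ∀ ω, 0 < μ ω) (hP : ∀ ω s, 0 ≤ P ω s) {ω : Ω} {s : S}
    (h : 0 < P ω s) : 0 < ∑ ω, μ ω * P ω s ^ α :=
  sum_pos' (fun ω' _ => mul_nonneg (hμ ω').le (rpow_nonneg (hP ω' s) α))
    ⟨ω, mem_univ ω, mul_pos (hμ ω) (rpow_pos_of_pos h α)⟩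

lemma hasDerivAt_sum_mul_rpow_rpow (hα : α ≠ 0) (hμ : ∀ ω, 0 < μ ω) (hP : ∀ ω s, 0 ≤ P ω s)
    (hD : ∀ ω s, D ω s ≠ 0 → 0 < P ω s) (s : S) :
    HasDerivAt (fun t : ℝ => (∑ ω, μ ω * (P ω s + t * D ω s) ^ α) ^ (1 / α))
      (∑ ω, μ ω * D ω s * ((∑ ω', μ ω' * P ω' s ^ α) ^ ((1 - α) / α) * P ω s ^ (α - 1))) 0 := by
  by_cases h : ∀ ω, D ω s = 0
  · simpa [h] using hasDerivAt_const (0 : ℝ) _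
  push Not at h
  obtain ⟨ω₀, h₀⟩ := h
  have hA := sum_mul_rpow_pos (α := α) hμ hP (hD ω₀ s h₀)
  have h_inner : HasDerivAt (fun t : ℝ => ∑ ω, μ ω * (P ω s + t * D ω s) ^ α)
      (∑ ω, μ ω * (D ω s * α * P ω s ^ (α - 1))) 0 := by
    refine HasDerivAt.fun_sum fun ω _ => HasDerivAt.const_mul _ ?_
    by_cases hω : D ω s = 0
    · simpa [hω] using hasDerivAt_const (0 : ℝ) _
    · have h_lin : HasDerivAt (fun t : ℝ => P ω s + t * D ω s) (D ω s) 0 := by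
        simpa using ((hasDerivAt_id (0 : ℝ)).mul_const (D ω s)).const_add (P ω s)
      simpa using h_lin.rpow_const (p := α) (Or.inl (by simpa using (hD ω s hω).ne'))
  have h_outer := h_inner.rpow_const (p := 1 / α) (Or.inl (by simpa using hA.ne'))
  convert h_outer using 1
  simp only [zero_mul, add_zero]
  rw [show 1 / α - 1 = (1 - α) / α by field_simp, sum_mul, sum_mul]
  refine sum_congr rfl fun ω _ => ?_
  field_simp

variable [Fintype S]

/-- Moving an experiment slightly along a direction which preserves total mass and is supported
on the positive entries yields an experiment. -/
lemma IsExperiment.eventually_add_mul (hP : IsExperiment P) (hD : ∀ ω s, D ω s ≠ 0 → 0 < P ω s)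
    (hD0 : ∀ ω, ∑ s, D ω s = 0) :
    ∀ᶠ t in nhds (0 : ℝ), IsExperiment fun ω s => P ω s + t * D ω s := by
  have h_nonneg : ∀ᶠ t in nhds (0 : ℝ), ∀ ω s, 0 ≤ P ω s + t * D ω s := by
    simp only [Filter.eventually_all]
    intro ω s
    by_cases h : D ω s = 0
    · simp [h, hP.1 ω s]
    · have hc : ContinuousAt (fun t : ℝ => P ω s + t * D ω s) 0 := by fun_prop
      have hpos : (0 : ℝ) < P ω s + 0 * D ω s := by simpa using hD ω s h
      filter_upwards [hc.eventually (lt_mem_nhds hpos)] with t ht using ht.le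
  filter_upwards [h_nonneg] with t ht
  refine ⟨ht, fun ω => ?_⟩
  rw [sum_add_distrib, ← mul_sum, hD0, hP.2]
  simp

lemma sum_sum_mul_rpow_rpow_pos (hμ : ∀ ω, 0 < μ ω) (hP : ∀ ω s, 0 ≤ P ω s) {ω : Ω} {s : S}
    (h : 0 < P ω s) : 0 < ∑ s, (∑ ω, μ ω * P ω s ^ α) ^ (1 / α) :=
  sum_pos' (fun s' _ => rpow_nonneg
      (sum_nonneg fun ω' _ => mul_nonneg (hμ ω').le (rpow_nonneg (hP ω' s') α)) _)
    ⟨s, mem_univ s, rpow_pos_of_pos (sum_mul_rpow_pos hμ hP h) _⟩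

lemma hasDerivAt_alphaMI (hα : α ≠ 0) (hμ : ∀ ω, 0 < μ ω) (hP : ∀ ω s, 0 ≤ P ω s)
    (hD : ∀ ω s, D ω s ≠ 0 → 0 < P ω s)
    (hC : ∑ s, (∑ ω, μ ω * P ω s ^ α) ^ (1 / α) ≠ 0) :
    HasDerivAt (fun t : ℝ => alphaMI α (fun ω s => P ω s + t * D ω s) μ)
      (∑ ω, ∑ s, μ ω * D ω s * ((α / (α - 1)) *
        (∑ s, (∑ ω, μ ω * P ω s ^ α) ^ (1 / α))⁻¹ *
        (∑ ω', μ ω' * P ω' s ^ α) ^ ((1 - α) / α) * P ω s ^ (α - 1))) 0 := by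
  have h_sum := HasDerivAt.fun_sum (u := univ) fun s _ =>
    hasDerivAt_sum_mul_rpow_rpow hα hμ hP hD s
  have h_log := (h_sum.log (by simpa using hC)).const_mul (α / (α - 1))
  refine h_log.congr_deriv (Eq.symm ?_)
  simp only [zero_mul, add_zero]
  rw [sum_comm, sum_div, mul_sum]
  refine sum_congr rfl fun s _ => ?_
  rw [sum_div, mul_sum]
  refine sum_congr rfl fun ω _ => ?_
  ring

/-- The objective is stationary at an optimum along mass-preserving directions supported on the
positive entries. -/
lemma IsAlphaRIOptimum.sum_mul_direction_eq_zero {u : S → Ω → ℝ} {κ : ℝ}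
    (hopt : IsAlphaRIOptimum α u κ μ P) (hα : α ≠ 0) (hμ : ∀ ω, 0 < μ ω)
    (hD : ∀ ω s, D ω s ≠ 0 → 0 < P ω s) (hD0 : ∀ ω, ∑ s, D ω s = 0)
    (hC : ∑ s, (∑ ω, μ ω * P ω s ^ α) ^ (1 / α) ≠ 0) :
    ∑ ω, ∑ s, μ ω * D ω s * (u s ω - κ * ((α / (α - 1)) *
        (∑ s, (∑ ω, μ ω * P ω s ^ α) ^ (1 / α))⁻¹ *
        (∑ ω', μ ω' * P ω' s ^ α) ^ ((1 - α) / α) * P ω s ^ (α - 1))) = 0 := by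
  have h_util : HasDerivAt (fun t : ℝ => ∑ ω, ∑ s, μ ω * (P ω s + t * D ω s) * u s ω)
      (∑ ω, ∑ s, μ ω * D ω s * u s ω) 0 := by
    refine HasDerivAt.fun_sum fun ω _ => HasDerivAt.fun_sum fun s _ => ?_
    have h_lin : HasDerivAt (fun t : ℝ => P ω s + t * D ω s) (D ω s) 0 := by
      simpa using ((hasDerivAt_id (0 : ℝ)).mul_const (D ω s)).const_add (P ω s)
    exact (h_lin.const_mul (μ ω)).mul_const (u s ω)
  have h_deriv := h_util.sub ((hasDerivAt_alphaMI hα hμ hopt.1.1 hD hC).const_mul κ)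
  have h_max : IsLocalMax ((fun t : ℝ => ∑ ω, ∑ s, μ ω * (P ω s + t * D ω s) * u s ω) -
      fun t : ℝ => κ * alphaMI α (fun ω s => P ω s + t * D ω s) μ) 0 := by
    filter_upwards [hopt.1.eventually_add_mul hD hD0] with t ht
    simpa using hopt.2 _ ht
  rw [← h_max.hasDerivAt_eq_zero h_deriv, mul_sum, ← sum_sub_distrib]
  refine sum_congr rfl fun ω _ => ?_
  rw [mul_sum, ← sum_sub_distrib]
  refine sum_congr rfl fun s _ => ?_
  ring

end FeasibleDirections

theorem alphaRI_interior_first_order_conditions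
    {Ω S : Type*} [Fintype Ω] [Fintype S]
    (α : ℝ) (hα0 : 0 < α) (hα1 : α ≠ 1)
    (μ : Ω → ℝ) (hμ : IsPrior μ) (hμpos : ∀ ω, 0 < μ ω)
    (u : S → Ω → ℝ) (κ : ℝ) (hκ : 0 < κ)
    (Pstar : Ω → S → ℝ) (hopt : IsAlphaRIOptimum α u κ μ Pstar)
    (C : ℝ) (hC : C = ∑ s, (∑ ω, μ ω * Pstar ω s ^ α) ^ (1 / α)) :
    ∃ lam : Ω → ℝ, ∀ s : S, ∀ ω : Ω, 0 < Pstar ω s →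
      (α / (α - 1)) * C⁻¹ *
          (∑ ω', μ ω' * Pstar ω' s ^ α) ^ ((1 - α) / α) * Pstar ω s ^ (α - 1)
        = u s ω / κ - lam ω / μ ω := by
  classical
  suffices h : ∀ ω, ∃ l : ℝ, ∀ s, 0 < Pstar ω s →
      (α / (α - 1)) * C⁻¹ *
          (∑ ω', μ ω' * Pstar ω' s ^ α) ^ ((1 - α) / α) * Pstar ω s ^ (α - 1)
        = u s ω / κ - l / μ ω by
    choose lam hlam using h
    exact ⟨lam, fun s ω => hlam ω s⟩
  intro ω
  by_cases hω : ∃ s, 0 < Pstar ω s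
  swap
  · exact ⟨0, fun s hs => (hω ⟨s, hs⟩).elim⟩
  obtain ⟨s₀, hs₀⟩ := hω
  set f : S → ℝ := fun s => (α / (α - 1)) * C⁻¹ *
    (∑ ω', μ ω' * Pstar ω' s ^ α) ^ ((1 - α) / α) * Pstar ω s ^ (α - 1) with hf
  refine ⟨μ ω * (u s₀ ω / κ - f s₀), fun s hs => ?_⟩
  change f s = _
  let d : S → ℝ := fun s' => (if s' = s then 1 else 0) - (if s' = s₀ then 1 else 0)
  have h_supp : ∀ ω' s', (if ω' = ω then d s' else 0) ≠ 0 → 0 < Pstar ω' s' := by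
    intro ω' s' h
    by_cases h1 : ω' = ω
    · subst h1
      by_cases h2 : s' = s
      · exact h2 ▸ hs
      · by_cases h3 : s' = s₀
        · exact h3 ▸ hs₀
        · simp [d, h2, h3] at h
    · simp [h1] at h
  have h_mass : ∀ ω', ∑ s', (if ω' = ω then d s' else 0) = 0 := by
    intro ω'
    by_cases h1 : ω' = ω <;> simp [h1, d]
  have h_stat := hopt.sum_mul_direction_eq_zero hα0.ne' hμpos h_supp h_mass
    (sum_sum_mul_rpow_rpow_pos hμpos hopt.1.1 hs₀).ne'
  rw [← hC, sum_eq_single ω (fun ω' _ h => by simp [h]) (by simp)] at h_stat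
  replace h_stat : ∑ s', μ ω * d s' * (u s' ω - κ * f s') = 0 := by simpa [hf] using h_stat
  simp only [d, mul_sub, sub_mul, sum_sub_distrib, mul_ite, ite_mul, mul_one, mul_zero, zero_mul,
    sum_ite_eq', mem_univ, if_true] at h_stat
  have hμω := hμpos ω
  have h_eq : u s ω - κ * f s = u s₀ ω - κ * f s₀ := by
    apply mul_left_cancel₀ hμω.ne'
    linear_combination h_stat
  rw [mul_div_cancel_left₀ _ hμω.ne']
  field_simp
  linear_combination -h_eq
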